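/- There is a constant C > 0 such that for all y with 0 < y ≤ 3^{−1/4}, |G₁(y) − G₁(0) + 3·2^{−2/3}·y^{2/3}| ≤ C·y^{10/3}; that is, G₁(y) = G₁(0) − 3·2^{−2/3} y^{2/3} + O(y^{10/3}) as y → 0⁺. -/

import Mathlib

open Real

/-- G₁(y) = ∫_y^{3^{−1/4}} t^{−1/3}·[(1 + √(1 − t⁸/27))^{1/3} + (1 − √(1 − t⁸/27))^{1/3}] dt. -/
noncomputable def G1 (y : ℝ) : ℝ :=
  ∫ t in y..(3:ℝ) ^ (-(1:ℝ)/4),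
    t ^ (-(1:ℝ)/3) * ((1 + Real.sqrt (1 - t ^ 8 / 27)) ^ ((1:ℝ)/3)
      + (1 - Real.sqrt (1 - t ^ 8 / 27)) ^ ((1:ℝ)/3))

/-- The integrand of `G1` is interval integrable on every interval. -/
lemma G1_integrand_intervalIntegrable (a b : ℝ) :
    IntervalIntegrable (fun t : ℝ => t ^ (-(1:ℝ)/3) * ((1 + Real.sqrt (1 - t ^ 8 / 27)) ^ ((1:ℝ)/3)
      + (1 - Real.sqrt (1 - t ^ 8 / 27)) ^ ((1:ℝ)/3))) MeasureTheory.volume a b := by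
  refine (intervalIntegral.intervalIntegrable_rpow' (by norm_num)).mul_continuousOn
    (Continuous.continuousOn ?_)
  exact (Continuous.rpow_const (by fun_prop) fun _ => Or.inr (by norm_num)).add
    (Continuous.rpow_const (by fun_prop) fun _ => Or.inr (by norm_num))

/-- By subadditivity of the cube root, the sum of the cube roots of `1 ± √(1 - u)` exceeds `2 ^ (1/3)`
by at most `u ^ (1/3)`. -/
lemma abs_cbrt_one_add_sqrt_add_cbrt_one_sub_sqrt_sub_le {u : ℝ} (hu₀ : 0 ≤ u) (hu₁ : u ≤ 1) :
    |(1 + √(1 - u)) ^ ((1:ℝ)/3) + (1 - √(1 - u)) ^ ((1:ℝ)/3) - 2 ^ ((1:ℝ)/3)|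
      ≤ u ^ ((1:ℝ)/3) := by
  have hs₀ : 0 ≤ √(1 - u) := Real.sqrt_nonneg _
  have hs₁ : √(1 - u) ≤ 1 := Real.sqrt_le_one.mpr (by linarith)
  have hsq : √(1 - u) ^ 2 = 1 - u := Real.sq_sqrt (by linarith)
  generalize √(1 - u) = s at *
  have lower := Real.rpow_add_le_add_rpow (p := (1:ℝ)/3) (a := 1 + s) (b := 1 - s)
    (by linarith) (by linarith) (by norm_num) (by norm_num)
  rw [show 1 + s + (1 - s) = 2 by ring] at lower
  have upper : (1 + s) ^ ((1:ℝ)/3) ≤ 2 ^ ((1:ℝ)/3) :=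
    Real.rpow_le_rpow (by linarith) (by linarith) (by norm_num)
  have small : (1 - s) ^ ((1:ℝ)/3) ≤ u ^ ((1:ℝ)/3) :=
    Real.rpow_le_rpow (by linarith) (by nlinarith) (by norm_num)
  rw [abs_of_nonneg (by linarith)]
  linarith

theorem G1_expansion_at_zero :
    ∃ C > (0:ℝ), ∀ y : ℝ, 0 < y → y ≤ (3:ℝ) ^ (-(1:ℝ)/4) →
      |G1 y - G1 0 + 3 * 2 ^ (-(2:ℝ)/3) * y ^ ((2:ℝ)/3)| ≤ C * y ^ ((10:ℝ)/3) := by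
  refine ⟨1, one_pos, fun y hy hy3 => ?_⟩
  have hy1 : y ≤ 1 := hy3.trans (Real.rpow_le_one_of_one_le_of_nonpos (by norm_num) (by norm_num))
  have main_term : ∫ t in (0:ℝ)..y, t ^ (-(1:ℝ)/3) * 2 ^ ((1:ℝ)/3)
      = 3 * 2 ^ (-(2:ℝ)/3) * y ^ ((2:ℝ)/3) := by
    have h2 : (2:ℝ) ^ ((1:ℝ)/3) = 2 * 2 ^ (-(2:ℝ)/3) := by
      rw [← Real.rpow_one_add' (by norm_num) (by norm_num)]
      norm_num
    rw [intervalIntegral.integral_mul_const, integral_rpow (Or.inl (by norm_num)),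
      show -(1:ℝ)/3 + 1 = 2/3 by norm_num, Real.zero_rpow (by norm_num), h2]
    ring
  have remainder : G1 y - G1 0 + 3 * 2 ^ (-(2:ℝ)/3) * y ^ ((2:ℝ)/3)
      = -∫ t in (0:ℝ)..y, (t ^ (-(1:ℝ)/3) * ((1 + Real.sqrt (1 - t ^ 8 / 27)) ^ ((1:ℝ)/3)
          + (1 - Real.sqrt (1 - t ^ 8 / 27)) ^ ((1:ℝ)/3)) - t ^ (-(1:ℝ)/3) * 2 ^ ((1:ℝ)/3)) := by
    rw [intervalIntegral.integral_sub (G1_integrand_intervalIntegrable 0 y)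
      ((intervalIntegral.intervalIntegrable_rpow' (by norm_num)).mul_const _), main_term,
      G1, G1, ← intervalIntegral.integral_add_adjacent_intervals
        (G1_integrand_intervalIntegrable 0 y) (G1_integrand_intervalIntegrable y _)]
    ring
  rw [remainder, abs_neg, one_mul, ← Real.norm_eq_abs]
  have bound := intervalIntegral.norm_integral_le_of_norm_le_const (a := 0) (b := y)
    (C := y ^ ((7:ℝ)/3)) (f := fun t : ℝ =>
      t ^ (-(1:ℝ)/3) * ((1 + Real.sqrt (1 - t ^ 8 / 27)) ^ ((1:ℝ)/3)
        + (1 - Real.sqrt (1 - t ^ 8 / 27)) ^ ((1:ℝ)/3)) - t ^ (-(1:ℝ)/3) * 2 ^ ((1:ℝ)/3)) ?_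
  · refine bound.trans_eq ?_
    rw [sub_zero, abs_of_pos hy, ← Real.rpow_add_one hy.ne']
    norm_num
  · intro t ht
    rw [Set.uIoc_of_le hy.le] at ht
    obtain ⟨ht0, hty⟩ := ht
    have ht8 : t ^ 8 ≤ 1 := pow_le_one₀ ht0.le (hty.trans hy1)
    have ht8' : 0 ≤ t ^ 8 := by positivity
    rw [← mul_sub, norm_mul, Real.norm_of_nonneg (by positivity), Real.norm_eq_abs]
    calc _ ≤ t ^ (-(1:ℝ)/3) * (t ^ 8 / 27) ^ ((1:ℝ)/3) := by
          gcongr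
          exact abs_cbrt_one_add_sqrt_add_cbrt_one_sub_sqrt_sub_le (by positivity) (by linarith)
      _ ≤ t ^ (-(1:ℝ)/3) * (t ^ 8) ^ ((1:ℝ)/3) := by
          gcongr
          linarith
      _ = t ^ ((7:ℝ)/3) := by
          rw [← Real.rpow_natCast, ← Real.rpow_mul ht0.le, ← Real.rpow_add ht0]
          norm_num
      _ ≤ y ^ ((7:ℝ)/3) := by gcongr
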